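/- Let k ≥ 3 and i be integers with 1 ≤ i and 2i < k, and let ℓ ≥ 2 be an integer such that for every positive integer m, ℓ(3ℓ−1) ≠ k·m² + m·(k−2i) and ℓ(3ℓ−1) ≠ k·m² − m·(k−2i). Then there exists an integer n with 2ℓ−1 ≤ n ≤ ℓ(3ℓ−1)/2 such that C̄_{k,i}(n) is odd. -/

import Mathlib

/-- Andrews' singular overpartition function `C̄_{k,i}(n)`: the number of pairs `(λ, S)`
where `λ` is a partition of `n` with no part divisible by `k` and `S` is a set of
part-values of `λ`, each congruent to `i` or `-i` modulo `k`. -/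
noncomputable def singularOverpartition (k i n : ℕ) : ℕ :=
  Nat.card {P : n.Partition × Finset ℕ //
    (∀ j ∈ P.1.parts, ¬ k ∣ j) ∧
    P.2 ⊆ P.1.parts.toFinset ∧
    ∀ x ∈ P.2, (x : ZMod k) = (i : ZMod k) ∨ (x : ZMod k) = -(i : ZMod k)}

open PowerSeries Finset

section QBinomial
variable {R : Type*} [CommRing R]

/-- The `q`-Pochhammer symbol `(q; q)_n = (1 - q) ⋯ (1 - q ^ n)`. -/
def qPochhammer (q : R) (n : ℕ) : R := ∏ j ∈ range n, (1 - q ^ (j + 1))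

/-- The Gaussian binomial coefficient, defined by its `q`-Pascal recurrence. -/
def gaussBinom (q : R) : ℕ → ℕ → R
  | _, 0 => 1
  | 0, _ + 1 => 0
  | n + 1, r + 1 => gaussBinom q n (r + 1) + q ^ (n - r) * gaussBinom q n r

theorem gaussBinom_eq_zero (q : R) : ∀ {n r : ℕ}, n < r → gaussBinom q n r = 0
  | 0, _ + 1, _ => by simp [gaussBinom]
  | n + 1, r + 1, h => by
    rw [gaussBinom, gaussBinom_eq_zero q (by lia), gaussBinom_eq_zero q (by lia)]
    simp

theorem gaussBinom_mul_qPochhammer (q : R) : ∀ {n r : ℕ}, r ≤ n →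
    gaussBinom q n r * (qPochhammer q r * qPochhammer q (n - r)) = qPochhammer q n
  | n, 0, _ => by cases n <;> simp [gaussBinom, qPochhammer]
  | n + 1, r + 1, h => by
    have hr : r ≤ n := by lia
    have ih := gaussBinom_mul_qPochhammer q hr
    have hs (m : ℕ) : qPochhammer q (m + 1) = qPochhammer q m * (1 - q ^ (m + 1)) :=
      prod_range_succ _ _
    rw [gaussBinom, Nat.add_sub_add_right, hs n]
    obtain rfl | hlt := hr.eq_or_lt
    · rw [gaussBinom_eq_zero q (Nat.lt_succ_self r), hs r]
      simp only [Nat.sub_self, pow_zero] at ih ⊢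
      linear_combination (1 - q ^ (r + 1)) * ih
    · have ih' := gaussBinom_mul_qPochhammer q (Nat.succ_le_of_lt hlt)
      obtain ⟨d, rfl⟩ := Nat.exists_eq_add_of_lt hlt
      have e1 : r + d + 1 - (r + 1) = d := by lia
      have e2 : r + d + 1 - r = d + 1 := by lia
      rw [Nat.succ_eq_add_one, e1] at ih'
      rw [e2] at ih ⊢
      rw [hs d] at ih ⊢
      rw [hs r] at ih' ⊢
      linear_combination (1 - q ^ (d + 1)) * ih' + q ^ (d + 1) * (1 - q ^ (r + 1)) * ih

/-- The homogeneous `q`-binomial theorem. -/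
theorem prod_add_mul_pow_eq_sum_gaussBinom (q x y : R) (n : ℕ) :
    ∏ j ∈ range n, (y + x * q ^ j) =
      ∑ r ∈ range (n + 1), gaussBinom q n r * q ^ (r.choose 2) * x ^ r * y ^ (n - r) := by
  induction n with
  | zero => simp [gaussBinom]
  | succ n ih =>
    rw [prod_range_succ, ih, mul_add, sum_range_succ' _ (n + 1)]
    have hlast : ∑ r ∈ range (n + 1), gaussBinom q n r * q ^ (r.choose 2) * x ^ r * y ^ (n - r) =
        ∑ r ∈ range (n + 1), gaussBinom q n (r + 1) * q ^ ((r + 1).choose 2) * x ^ (r + 1) *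
          y ^ (n - (r + 1)) + y ^ n := by
      rw [sum_range_succ', sum_range_succ, gaussBinom_eq_zero q (Nat.lt_succ_self n)]
      cases n <;> simp [gaussBinom]
    nth_rw 1 [hlast]
    have hterm : ∀ r ∈ range (n + 1),
        gaussBinom q (n + 1) (r + 1) * q ^ ((r + 1).choose 2) * x ^ (r + 1) *
          y ^ (n + 1 - (r + 1)) =
        gaussBinom q n (r + 1) * q ^ ((r + 1).choose 2) * x ^ (r + 1) * y ^ (n - (r + 1)) * y +
        gaussBinom q n r * q ^ (r.choose 2) * x ^ r * y ^ (n - r) * (x * q ^ n) := by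
      intro r hr
      have hr : r ≤ n := by simpa [Nat.lt_succ_iff] using hr
      have hc : (r + 1).choose 2 = r + r.choose 2 := by
        rw [Nat.choose_succ_succ' r 1, Nat.choose_one_right]
      rw [gaussBinom, Nat.add_sub_add_right]
      obtain ⟨d, rfl⟩ := Nat.exists_eq_add_of_le hr
      rw [hc, Nat.add_sub_cancel_left]
      cases d with
      | zero =>
        rw [Nat.add_zero, gaussBinom_eq_zero q (Nat.lt_succ_self r)]
        ring
      | succ d =>
        have e : r + (d + 1) - (r + 1) = d := by lia
        rw [e]
        ring
    rw [sum_congr rfl hterm, sum_add_distrib, add_mul, sum_mul, sum_mul]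
    simp [gaussBinom]
    ring

theorem pow_dvd_qPochhammer_sub (q : R) {m n : ℕ} (h : m ≤ n) :
    q ^ (m + 1) ∣ qPochhammer q n - qPochhammer q m := by
  induction n, h using Nat.le_induction with
  | base => simp
  | succ n hn ih =>
    have hd : q ^ (m + 1) ∣ q ^ (n + 1) := pow_dvd_pow q (by lia)
    rw [qPochhammer, prod_range_succ, ← qPochhammer]
    have e : qPochhammer q n * (1 - q ^ (n + 1)) - qPochhammer q m =
      (qPochhammer q n - qPochhammer q m) - qPochhammer q n * q ^ (n + 1) := by ring
    rw [e]
    exact dvd_sub ih (hd.mul_left _)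

end QBinomial

theorem isUnit_qPochhammer_X_pow {R : Type*} [CommRing R] {k : ℕ} (hk : k ≠ 0) (n : ℕ) :
    IsUnit (qPochhammer (X ^ k : R⟦X⟧) n) := by
  rw [PowerSeries.isUnit_iff_constantCoeff, qPochhammer, map_prod]
  simp [hk]

theorem X_pow_dvd_gaussBinom_mul_qPochhammer_sub_one {R : Type*} [CommRing R] {k : ℕ} (hk : k ≠ 0)
    {M r d : ℕ} (hdM : d ≤ M) (hdr : d ≤ r) (hr : r + d ≤ 2 * M) :
    (X ^ (k * (d + 1)) : R⟦X⟧) ∣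
      qPochhammer (X ^ k) M * gaussBinom (X ^ k) (2 * M) r - 1 := by
  set q : R⟦X⟧ := X ^ k with hq
  have hW : IsUnit (qPochhammer q r * qPochhammer q (2 * M - r)) :=
    (isUnit_qPochhammer_X_pow hk _).mul (isUnit_qPochhammer_X_pow hk _)
  rw [← hW.dvd_mul_left, pow_mul]
  have h := gaussBinom_mul_qPochhammer q (show r ≤ 2 * M by lia)
  have e : qPochhammer q r * qPochhammer q (2 * M - r) *
      (qPochhammer q M * gaussBinom q (2 * M) r - 1) =
      (qPochhammer q M - qPochhammer q d) * qPochhammer q (2 * M) +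
      qPochhammer q d * (qPochhammer q (2 * M) - qPochhammer q d) -
      (qPochhammer q r - qPochhammer q d) * qPochhammer q (2 * M - r) -
      qPochhammer q d * (qPochhammer q (2 * M - r) - qPochhammer q d) := by
    linear_combination qPochhammer q M * h
  rw [e]
  have hd {n : ℕ} (hn : d ≤ n) := pow_dvd_qPochhammer_sub q hn
  exact dvd_sub (dvd_sub (dvd_add ((hd hdM).mul_right _) ((hd (by lia)).mul_left _))
    ((hd hdr).mul_right _)) ((hd (by lia)).mul_left _)

theorem two_mul_gaussBinom_exponent (k i M r : ℕ) (hr : r ≤ 2 * M) :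
    (2 * (k * r.choose 2 + i * r + k * M * (2 * M - r) : ℕ) : ℤ) =
      2 * (k * M * M + i * M + k * M.choose 2 : ℕ) +
        (k * ((r : ℤ) - M) ^ 2 - ((r : ℤ) - M) * (k - 2 * i)) := by
  have hc (n : ℕ) : (2 * n.choose 2 : ℤ) = n * (n - 1) := by
    cases n with
    | zero => simp
    | succ n =>
      have h := Nat.add_one_mul_choose_eq n 1
      rw [Nat.choose_one_right] at h
      push_cast
      have h' : ((n : ℤ) + 1) * n = (n + 1).choose 2 * 2 := by exact_mod_cast h
      linarith
  push_cast [Nat.cast_sub hr]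
  linear_combination k * hc r - k * hc M

/-- A finite form of the Jacobi triple product identity, multiplied by a power of `X` that clears
the negative exponents. -/
theorem X_pow_mul_prod_eq_sum_gaussBinom {R : Type*} [CommRing R] {k i : ℕ} (hi : i ≤ k) (M : ℕ) :
    (X ^ (k * M * M + i * M + k * M.choose 2) *
      ∏ j ∈ range M, ((1 + X ^ (k * j + i)) * (1 + X ^ (k * j + (k - i)))) : R⟦X⟧) =
    ∑ r ∈ range (2 * M + 1), gaussBinom (X ^ k) (2 * M) r *
      X ^ (k * r.choose 2 + i * r + k * M * (2 * M - r)) := by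
  have h := prod_add_mul_pow_eq_sum_gaussBinom (X ^ k : R⟦X⟧) (X ^ i) (X ^ (k * M)) (2 * M)
  have hr : ∀ r ∈ range (2 * M + 1), gaussBinom (X ^ k) (2 * M) r *
      (X : R⟦X⟧) ^ (k * r.choose 2 + i * r + k * M * (2 * M - r)) =
      gaussBinom (X ^ k) (2 * M) r * (X ^ k) ^ (r.choose 2) * (X ^ i) ^ r *
        (X ^ (k * M)) ^ (2 * M - r) := by
    intro r _
    simp only [← pow_mul, pow_add]
    ring
  rw [sum_congr rfl hr, ← h, two_mul, prod_range_add, prod_mul_distrib]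
  have h1 : ∏ j ∈ range M, (X ^ (k * M) + X ^ i * (X ^ k) ^ (M + j) : R⟦X⟧) =
      X ^ (k * M * M) * ∏ j ∈ range M, (1 + X ^ (k * j + i)) := by
    have e : (X : R⟦X⟧) ^ (k * M * M) = ∏ _j ∈ range M, X ^ (k * M) := by simp [pow_mul]
    rw [e, ← prod_mul_distrib]
    exact prod_congr rfl fun j _ ↦ by ring
  have h2 : ∏ j ∈ range M, (X ^ (k * M) + X ^ i * (X ^ k) ^ j : R⟦X⟧) =
      X ^ (i * M + k * M.choose 2) * ∏ j ∈ range M, (1 + X ^ (k * j + (k - i))) := by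
    have e (n : ℕ) : (X : R⟦X⟧) ^ (i * n + k * n.choose 2) =
        ∏ j ∈ range n, X ^ (i + k * j) := by
      induction n with
      | zero => simp
      | succ n ih =>
        rw [prod_range_succ, ← ih, Nat.choose_succ_succ' n 1, Nat.choose_one_right]
        ring
    rw [e, ← prod_range_reflect (fun j ↦ 1 + (X : R⟦X⟧) ^ (k * j + (k - i))), ← prod_mul_distrib]
    refine prod_congr rfl fun j hj ↦ ?_
    have hj : j < M := by simpa using hj
    obtain ⟨c, rfl⟩ := Nat.exists_eq_add_of_lt hj
    obtain ⟨t, rfl⟩ := Nat.exists_eq_add_of_le hi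
    have e1 : j + c + 1 - 1 - j = c := by lia
    rw [e1, Nat.add_sub_cancel_left]
    ring
  rw [h1, h2]
  ring

/-- If `n` is not of the form `(k m² - m (k - 2 i)) / 2`, then the coefficient of `X ^ n` in a
sufficiently long partial product of the Jacobi triple product vanishes. -/
theorem coeff_jacobi_prod_eq_zero {R : Type*} [CommRing R] {k i n M : ℕ} (hik : 2 * i < k)
    (hM : n < M) (hn : ∀ m : ℤ, 2 * (n : ℤ) ≠ k * m ^ 2 - m * (k - 2 * i)) :
    coeff n (∏ j ∈ range M, ((1 - X ^ (k * j + k)) * (1 + X ^ (k * j + i)) *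
      (1 + X ^ (k * j + (k - i)))) : R⟦X⟧) = 0 := by
  set E := k * M * M + i * M + k * M.choose 2 with hE
  have hq : ∏ j ∈ range M, (1 - X ^ (k * j + k) : R⟦X⟧) = qPochhammer (X ^ k) M :=
    prod_congr rfl fun j _ ↦ by ring
  simp_rw [mul_assoc]
  rw [← coeff_X_pow_mul _ E, prod_mul_distrib, mul_left_comm,
    X_pow_mul_prod_eq_sum_gaussBinom (by lia), hq, mul_sum, map_sum]
  refine sum_eq_zero fun r hr ↦ ?_
  have hr : r ≤ 2 * M := by simpa [Nat.lt_succ_iff] using hr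
  have hexp := two_mul_gaussBinom_exponent k i M r hr
  rw [← hE] at hexp
  set f := k * r.choose 2 + i * r + k * M * (2 * M - r)
  have hf : n + E ≠ f := by
    intro hf
    apply hn (r - M)
    push_cast [← hf] at hexp
    linarith
  set d := min r (2 * M - r)
  have hdvd := X_pow_dvd_gaussBinom_mul_qPochhammer_sub_one (R := R) (k := k) (by lia)
    (M := M) (r := r) (d := d) (by lia) (by lia) (by lia)
  have hlt : n + E < k * (d + 1) + f := by
    have hkM : (n : ℤ) < k * M := by
      have : M ≤ k * M := Nat.le_mul_of_pos_left M (by lia)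
      exact_mod_cast hM.trans_le this
    have hk : (2 * i : ℤ) < k := by exact_mod_cast hik
    zify
    suffices 0 ≤ 2 * (k : ℤ) * (d + 1) + (k * ((r : ℤ) - M) ^ 2 - ((r : ℤ) - M) * (k - 2 * i))
      - 2 * k * M by linarith
    obtain hrM | hrM := le_total r M
    · have hd : (d : ℤ) = r := by lia
      obtain ⟨t, rfl⟩ := Nat.exists_eq_add_of_le hrM
      rw [hd]
      push_cast
      have h1 : 0 ≤ (k : ℤ) * ((t - 1) ^ 2 + 1) := by positivity
      have h2 : 0 ≤ (t : ℤ) * (k - 2 * i) := mul_nonneg (by positivity) (by linarith)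
      linarith
    · obtain ⟨t, rfl⟩ := Nat.exists_eq_add_of_le hrM
      have hd : (d : ℤ) = M - t := by lia
      rw [hd]
      push_cast
      have h1 : 0 ≤ (k : ℤ) * ((t - 1) * (t - 2)) := by
        refine mul_nonneg (by positivity) ?_
        obtain ht | ht : t ≤ 1 ∨ 2 ≤ t := by lia
        · exact mul_nonneg_of_nonpos_of_nonpos (by lia) (by lia)
        · exact mul_nonneg (by lia) (by lia)
      have h2 : 0 ≤ (t : ℤ) * (2 * i) := by positivity
      linarith
  have e : qPochhammer (X ^ k : R⟦X⟧) M * (gaussBinom (X ^ k) (2 * M) r * X ^ f) =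
      (qPochhammer (X ^ k) M * gaussBinom (X ^ k) (2 * M) r - 1) * X ^ f + X ^ f := by ring
  rw [e, map_add, coeff_X_pow, if_neg hf, add_zero]
  have hdvd' := mul_dvd_mul_right hdvd (X ^ f)
  rw [← pow_add] at hdvd'
  exact X_pow_dvd_iff.mp hdvd' _ hlt

/-- Counting sets `S` of overlined parts of `p` shows that `p` contributes an even number of
singular overpartitions as soon as it has a part congruent to `±i` modulo `k`. -/
theorem natCast_singularOverpartition (k i n : ℕ) :
    (singularOverpartition k i n : ZMod 2) = #(Nat.Partition.restricted n fun x ↦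
      ¬ k ∣ x ∧ ¬ ((x : ZMod k) = i ∨ (x : ZMod k) = -i)) := by
  rw [singularOverpartition, Nat.card_congr (Equiv.subtypeProdEquivSigmaSubtype fun
    (p : n.Partition) (S : Finset ℕ) ↦ (∀ j ∈ p.parts, ¬ k ∣ j) ∧ S ⊆ p.parts.toFinset ∧
      ∀ x ∈ S, (x : ZMod k) = (i : ZMod k) ∨ (x : ZMod k) = -(i : ZMod k))]
  have hfib (p : n.Partition) : {S : Finset ℕ | (∀ j ∈ p.parts, ¬ k ∣ j) ∧ S ⊆ p.parts.toFinset ∧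
      ∀ x ∈ S, (x : ZMod k) = (i : ZMod k) ∨ (x : ZMod k) = -(i : ZMod k)} =
      if ∀ j ∈ p.parts, ¬ k ∣ j then
        ↑(p.parts.toFinset.filter
          fun x : ℕ ↦ (x : ZMod k) = i ∨ (x : ZMod k) = -i).powerset
      else (∅ : Set (Finset ℕ)) := by
    split_ifs with h
    · ext S
      simp only [Set.mem_ofPred_eq, mem_coe, mem_powerset, subset_iff, mem_filter]
      grind
    · simp [h]
  have hcard (p : n.Partition) : (Nat.card {S : Finset ℕ // (∀ j ∈ p.parts, ¬ k ∣ j) ∧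
      S ⊆ p.parts.toFinset ∧ ∀ x ∈ S, (x : ZMod k) = (i : ZMod k) ∨ (x : ZMod k) = -(i : ZMod k)} :
      ZMod 2) = if ∀ x ∈ p.parts, ¬ k ∣ x ∧ ¬ ((x : ZMod k) = i ∨ (x : ZMod k) = -i)
        then 1 else 0 := by
    change ((Nat.card ↥{S : Finset ℕ | _} : ℕ) : ZMod 2) = _
    rw [hfib]
    split_ifs with h1 h2 h2
    · rw [Nat.card_coe_set_eq, Set.ncard_coe_finset, card_powerset, filter_false_of_mem]
      · simp
      · exact fun x hx ↦ (h2 x (by simpa using hx)).2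
    · rw [Nat.card_coe_set_eq, Set.ncard_coe_finset, card_powerset]
      push Not at h2
      obtain ⟨x, hx, hx'⟩ := h2
      have : (#(p.parts.toFinset.filter
          fun x : ℕ ↦ (x : ZMod k) = i ∨ (x : ZMod k) = -i)) ≠ 0 := by
        refine card_ne_zero_of_mem (a := x) ?_
        simpa [hx] using hx' (h1 x hx)
      have h20 : ((2 : ℕ) : ZMod 2) = 0 := rfl
      rw [Nat.cast_pow, h20, zero_pow this]
    · exact absurd (fun j hj ↦ (h2 j hj).1) h1
    · simp
  have (p : n.Partition) : Finite {S : Finset ℕ // (∀ j ∈ p.parts, ¬ k ∣ j) ∧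
      S ⊆ p.parts.toFinset ∧ ∀ x ∈ S, (x : ZMod k) = (i : ZMod k) ∨ (x : ZMod k) = -(i : ZMod k)} :=
    (p.parts.toFinset.powerset.finite_toSet.subset fun S hS ↦ by simpa using hS.2.1).to_subtype
  rw [Nat.card_sigma, Nat.cast_sum, sum_congr rfl fun p _ ↦ hcard p, Nat.Partition.restricted,
    card_filter]
  push_cast
  rfl

/-- In characteristic `2`, the factors `1 - X ^ j` with `j` congruent to `0` or `±i` modulo `k`
group into the factors of the Jacobi triple product. -/
theorem prod_range_mul_ite_eq {R : Type*} [CommRing R] [CharP R 2] {k i : ℕ} (hi : 1 ≤ i)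
    (hik : 2 * i < k) (M : ℕ) :
    ∏ j ∈ range (k * M), (if ¬ k ∣ j + 1 ∧
        ¬ (((j + 1 : ℕ) : ZMod k) = i ∨ ((j + 1 : ℕ) : ZMod k) = -i) then 1 else
          1 - (X : R⟦X⟧) ^ (j + 1)) =
      ∏ j ∈ range M, ((1 - X ^ (k * j + k)) * (1 + X ^ (k * j + i)) *
        (1 + X ^ (k * j + (k - i)))) := by
  have hneg (m : ℕ) : (1 + X ^ m : R⟦X⟧) = 1 - X ^ m := by
    have h2 : (2 : R⟦X⟧) = 0 := by
      rw [← map_ofNat (C (R := R)) 2, CharTwo.two_eq_zero, map_zero]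
    linear_combination X ^ m * h2
  have hmod {s : ℕ} (hs : s < k) (t : ℕ) : (¬ k ∣ k * t + s + 1 ∧
      ¬ (((k * t + s + 1 : ℕ) : ZMod k) = i ∨ ((k * t + s + 1 : ℕ) : ZMod k) = -i)) ↔
      s ∉ ({k - 1, i - 1, k - i - 1} : Finset ℕ) := by
    have hki : (-i : ZMod k) = ((k - i : ℕ) : ZMod k) := by
      rw [Nat.cast_sub (by lia)]; simp
    have e1 : ((k * t + s + 1 : ℕ) : ZMod k) = ((s + 1 : ℕ) : ZMod k) := by simp
    rw [hki, e1, ZMod.natCast_eq_natCast_iff', ZMod.natCast_eq_natCast_iff', add_assoc,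
      Nat.dvd_add_right (dvd_mul_right k t), Nat.dvd_iff_mod_eq_zero,
      Nat.mod_eq_of_lt (show i < k by lia), Nat.mod_eq_of_lt (show k - i < k by lia)]
    simp only [mem_insert, mem_singleton]
    obtain h | h : s + 1 < k ∨ s + 1 = k := by lia
    · rw [Nat.mod_eq_of_lt h]
      lia
    · rw [h, Nat.mod_self]
      lia
  induction M with
  | zero => simp
  | succ M ih =>
    rw [mul_add_one, prod_range_add, ih, prod_range_succ]
    congr 1
    rw [prod_congr rfl fun s hs ↦ if_congr (hmod (mem_range.mp hs) M) rfl rfl]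
    have hsub : ({k - 1, i - 1, k - i - 1} : Finset ℕ) ⊆ range k := by
      intro s
      simp only [mem_insert, mem_singleton, mem_range]
      lia
    rw [← prod_subset hsub fun s _ hs ↦ if_pos hs,
      prod_congr rfl fun s hs ↦ if_neg (not_not_intro hs), prod_insert, prod_insert, prod_singleton,
      hneg, hneg, mul_assoc]
    · have e1 : k * M + (k - 1) + 1 = k * M + k := by lia
      have e2 : k * M + (i - 1) + 1 = k * M + i := by lia
      have e3 : k * M + (k - i - 1) + 1 = k * M + (k - i) := by lia
      rw [e1, e2, e3]
    · simp only [mem_singleton]; lia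
    · simp only [mem_insert, mem_singleton]; lia

/-- Modulo `2`, the generating function of singular overpartitions times Euler's product has the
same coefficients as the Jacobi triple product. -/
theorem eventually_coeff_mul_pentagonalSeries {k i : ℕ} (hi : 1 ≤ i) (hik : 2 * i < k) (n : ℕ) :
    ∀ᶠ M in Filter.atTop,
      coeff n (∏ j ∈ range M, ((1 - X ^ (k * j + k)) * (1 + X ^ (k * j + i)) *
        (1 + X ^ (k * j + (k - i)))) : (ZMod 2)⟦X⟧) =
      coeff n (PowerSeries.mk (fun n ↦ (singularOverpartition k i n : ZMod 2)) *
        pentagonalSeries (ZMod 2)) := by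
  let : TopologicalSpace (ZMod 2) := ⊥
  have : DiscreteTopology (ZMod 2) := ⟨rfl⟩
  open scoped PowerSeries.WithPiTopology in
  have hprod := (Nat.Partition.hasProd_powerSeriesMk_card_restricted (ZMod 2) (fun x ↦
    ¬ k ∣ x ∧ ¬ ((x : ZMod k) = i ∨ (x : ZMod k) = -i))).mul
    (WithPiTopology.hasProd_one_sub_X_pow (ZMod 2))
  simp_rw [← natCast_singularOverpartition] at hprod
  have hterm (j : ℕ) : (if ¬ k ∣ j + 1 ∧
        ¬ (((j + 1 : ℕ) : ZMod k) = i ∨ ((j + 1 : ℕ) : ZMod k) = -i)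
        then ∑' c : ℕ, (X : (ZMod 2)⟦X⟧) ^ ((j + 1) * c) else 1) * (1 - X ^ (j + 1)) =
      if ¬ k ∣ j + 1 ∧
        ¬ (((j + 1 : ℕ) : ZMod k) = i ∨ ((j + 1 : ℕ) : ZMod k) = -i) then 1 else
          1 - X ^ (j + 1) := by
    split_ifs
    · simp_rw [pow_mul]
      exact WithPiTopology.tsum_pow_mul_one_sub_of_constantCoeff_eq_zero (by simp)
    · rw [one_mul]
  simp_rw [hterm] at hprod
  rw [HasProd, WithPiTopology.tendsto_iff_coeff_tendsto] at hprod
  have hlim := (hprod n).comp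
    (Filter.tendsto_finset_range.comp (Filter.tendsto_id.const_mul_atTop' (show 0 < k by lia)))
  rw [nhds_discrete, Filter.tendsto_pure] at hlim
  filter_upwards [hlim] with M hM
  rw [← hM, Function.comp_apply, Function.comp_apply, ← prod_range_mul_ite_eq hi hik]
  rfl

theorem singularOverpartition_zero (k i : ℕ) : Odd (singularOverpartition k i 0) := by
  rw [← ZMod.natCast_eq_one_iff_odd, natCast_singularOverpartition, Nat.Partition.restricted,
    filter_true_of_mem]
  · simp
  · intro p _ x hx
    simp [Subsingleton.elim p default] at hx

/-- There are no generalized pentagonal numbers strictly between those of index `1 - ℓ` and `ℓ`. -/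
theorem pentagonal_notMem_Ioo {ℓ : ℤ} (hℓ : 1 ≤ ℓ) (j : ℤ) :
    pentagonal j ∉ Set.Ioo (pentagonal (-(ℓ - 1))) (pentagonal ℓ) := by
  rintro ⟨h1, h2⟩
  obtain hj | hj := le_total 0 j
  · have hjl : j < ℓ := pentagonal_strictMonoOn.lt_iff_lt hj (by grind) |>.mp h2
    have h3 : pentagonal j ≤ pentagonal (-j) := by
      obtain rfl | hj := hj.eq_or_lt
      · simp
      · exact (pentagonal_lt_pentagonal_neg hj).le
    have h4 : pentagonal (-j) ≤ pentagonal (-(ℓ - 1)) :=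
      pentagonal_strictAntiOn.le_iff_ge (by grind) (by grind) |>.mpr (by lia)
    lia
  · have hjl : j < -(ℓ - 1) := pentagonal_strictAntiOn.lt_iff_gt (by grind) hj |>.mp h1
    have h3 : pentagonal ℓ < pentagonal (-ℓ) := pentagonal_lt_pentagonal_neg (by lia)
    have h4 : pentagonal (-ℓ) ≤ pentagonal j :=
      pentagonal_strictAntiOn.le_iff_ge (by grind) hj |>.mpr (by lia)
    lia

theorem stmt_8 (k i : ℕ) (hk : 3 ≤ k) (hi : 1 ≤ i) (hik : 2 * i < k)
    (ℓ : ℕ) (hℓ : 2 ≤ ℓ)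
    (h : ∀ m : ℕ, 0 < m →
      (ℓ : ℤ) * (3 * ℓ - 1) ≠ (k : ℤ) * m ^ 2 + m * ((k : ℤ) - 2 * i) ∧
      (ℓ : ℤ) * (3 * ℓ - 1) ≠ (k : ℤ) * m ^ 2 - m * ((k : ℤ) - 2 * i)) :
    ∃ n : ℕ, 2 * ℓ - 1 ≤ n ∧ n ≤ ℓ * (3 * ℓ - 1) / 2 ∧ Odd (singularOverpartition k i n) := by
  by_contra! hodd
  have hN : 2 * (pentagonal ℓ : ℤ) = ℓ * (3 * ℓ - 1) := two_mul_natCast_pentagonal ℓ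
  have hN' : ℓ * (3 * ℓ - 1) / 2 = pentagonal ℓ := by
    have : 2 * pentagonal ℓ = ℓ * (3 * ℓ - 1) := by
      zify [show 1 ≤ 3 * ℓ by lia]
      exact hN
    lia
  have hprev : (pentagonal (-(ℓ - 1)) : ℤ) = pentagonal ℓ - (2 * ℓ - 1) := by
    have := two_mul_natCast_pentagonal_neg ((ℓ : ℤ) - 1)
    linarith
  rw [hN'] at hodd
  have hexp (m : ℤ) : 2 * (pentagonal ℓ : ℤ) ≠ k * m ^ 2 - m * (k - 2 * i) := by
    rw [hN]
    obtain ⟨m, rfl | rfl⟩ := m.eq_nat_or_neg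
    all_goals obtain rfl | hm := m.eq_zero_or_pos
    · have : (0 : ℤ) < ℓ * (3 * ℓ - 1) := mul_pos (by lia) (by lia)
      simpa using this.ne'
    · exact (h m hm).2
    · have : (0 : ℤ) < ℓ * (3 * ℓ - 1) := mul_pos (by lia) (by lia)
      simpa using this.ne'
    · simpa [sub_neg_eq_add] using (h m hm).1
  obtain ⟨M, hM, hlt⟩ := ((eventually_coeff_mul_pentagonalSeries hi hik (pentagonal ℓ)).and
    (Filter.eventually_gt_atTop (pentagonal ℓ))).exists
  rw [coeff_jacobi_prod_eq_zero hik hlt hexp, coeff_mul,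
    sum_eq_single (0, pentagonal ℓ)] at hM
  · have h0 := ZMod.natCast_eq_one_iff_odd.mpr (singularOverpartition_zero k i)
    rw [coeff_mk, h0, coeff_pentagonalSeries_pentagonal, one_mul] at hM
    obtain h1 | h1 := Int.units_eq_one_or (Int.negOnePow ℓ) <;> simp [h1] at hM
  · rintro ⟨a, b⟩ hab hne
    have hab : a + b = pentagonal ℓ := by simpa using hab
    obtain ha | ha := le_or_gt (2 * ℓ - 1) a
    · have := hodd a ha (by lia)
      rw [Nat.not_odd_iff_even, ← ZMod.natCast_eq_zero_iff_even] at this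
      simp [this]
    · have ha0 : a ≠ 0 := by rintro rfl; simp_all
      rw [coeff_pentagonalSeries_eq_zero, mul_zero]
      rintro ⟨j, hj⟩
      refine pentagonal_notMem_Ioo (ℓ := ℓ) (by lia) j ⟨?_, ?_⟩
      · zify
        lia
      · lia
  · simp
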